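/- Let T be a tree with no proper nonempty invariant subtree under a non-elementary discrete subgroup Γ of Aut(T). If α ∈ Γ fixes pointwise a nonempty open subset U of the boundary ∂T, then α is the identity. -/

import Mathlib

open SimpleGraph

variable {V : Type*}

/-- A geodesic ray in a tree: an injective path of consecutive adjacent
vertices. -/
def IsGeodRay (G : SimpleGraph V) (r : ℕ → V) : Prop :=
  Function.Injective r ∧ ∀ n, G.Adj (r n) (r (n + 1))

/-- Two rays define the same end (boundary point) when they eventually
coincide up to a shift. -/
def RayEquiv (r s : ℕ → V) : Prop := ∃ a b : ℕ, ∀ n : ℕ, r (a + n) = s (b + n)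

namespace SimpleGraph

/-- The half-tree of an oriented edge `(a, b)`: the vertices lying on the side of `b`. -/
def halfTree (G : SimpleGraph V) (a b : V) : Set V := {x | G.dist x a = G.dist x b + 1}

variable {G : SimpleGraph V}

theorem mem_halfTree {a b x : V} : x ∈ G.halfTree a b ↔ G.dist x a = G.dist x b + 1 := Iff.rfl

theorem Adj.right_mem_halfTree {a b : V} (h : G.Adj a b) : b ∈ G.halfTree a b := by
  simpa [mem_halfTree] using h.symm

theorem left_notMem_halfTree {a b : V} : a ∉ G.halfTree a b := by
  simp [mem_halfTree]

theorem Connected.exists_adj_dist_eq_add_one (hG : G.Connected) {x v : V} (h : x ≠ v) :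
    ∃ u, G.Adj u v ∧ G.dist x v = G.dist x u + 1 := by
  obtain ⟨p, hp⟩ := hG.exists_walk_length_eq_dist v x
  cases p with
  | nil => exact absurd rfl h
  | cons hadj q =>
    rename_i u
    refine ⟨u, hadj.symm, ?_⟩
    have h1 := dist_le q
    have h2 := hG.dist_triangle (u := x) (v := u) (w := v)
    have h3 : G.dist u v = 1 := dist_eq_one_iff_adj.2 hadj.symm
    rw [Walk.length_cons] at hp
    rw [dist_comm (u := u) (v := x)] at h1
    rw [dist_comm (u := v) (v := x)] at hp
    omega

namespace IsTree

theorem adj_unique_of_dist_eq_add_one (hT : G.IsTree) {x u u' v : V} (h : G.Adj u v)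
    (h' : G.Adj u' v) (hd : G.dist x v = G.dist x u + 1) (hd' : G.dist x v = G.dist x u' + 1) :
    u = u' := by
  obtain ⟨p, hp⟩ := hT.connected.exists_walk_length_eq_dist u x
  obtain ⟨q, hq⟩ := hT.connected.exists_walk_length_eq_dist u' x
  rw [dist_comm] at hp hq hd hd'
  have hP : (Walk.cons h.symm p).IsPath := Walk.isPath_of_length_eq_dist _ (by
    rw [Walk.length_cons, hp, hd, dist_comm])
  have hQ : (Walk.cons h'.symm q).IsPath := Walk.isPath_of_length_eq_dist _ (by
    rw [Walk.length_cons, hq, hd', dist_comm])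
  have := congrArg Subtype.val ((hT.isAcyclic.subsingleton_path _ _).elim ⟨_, hP⟩ ⟨_, hQ⟩)
  simp only [Walk.cons.injEq] at this
  exact this.1

theorem notMem_halfTree_iff (hT : G.IsTree) {a b x : V} (h : G.Adj a b) :
    x ∉ G.halfTree a b ↔ x ∈ G.halfTree b a := by
  have := hT.dist_eq_dist_add_one_of_adj x h
  simp only [mem_halfTree]
  omega

/-- A vertex of a geodesic is determined by its distance to an endpoint. -/
theorem eq_of_dist_add_dist_eq (hT : G.IsTree) {x y z z' : V}
    (h : G.dist x z + G.dist z y = G.dist x y) (h' : G.dist x z' + G.dist z' y = G.dist x y)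
    (hz : G.dist x z = G.dist x z') : z = z' := by
  induction hk : G.dist x z generalizing x with
  | zero =>
    rw [hk] at hz
    rw [hT.connected.dist_eq_zero_iff] at hk
    rw [← hk, hT.connected.dist_eq_zero_iff.1 hz.symm]
  | succ k ih =>
    have key : ∀ w : V, G.dist x w + G.dist w y = G.dist x y → G.dist x w = k + 1 →
        ∃ u, G.Adj u x ∧ G.dist u w = k ∧ G.dist y x = G.dist y u + 1 ∧
          G.dist u w + G.dist w y = G.dist u y := by
      intro w hw hwk
      have hne : w ≠ x := by rintro rfl; simp at hwk
      obtain ⟨u, hu, hud⟩ := hT.connected.exists_adj_dist_eq_add_one hne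
      have h1 := hT.connected.dist_triangle (u := u) (v := w) (w := y)
      have h2 := hT.dist_eq_dist_add_one_of_adj y hu
      rw [dist_comm (u := w) (v := x), dist_comm (u := w) (v := u)] at hud
      rw [dist_comm (u := y) (v := x), dist_comm (u := y) (v := u)] at h2
      refine ⟨u, hu, by omega, ?_, by omega⟩
      rw [dist_comm (u := y) (v := x), dist_comm (u := y) (v := u)]
      omega
    obtain ⟨u, hu, hu1, hu2, hu3⟩ := key z h hk
    obtain ⟨u', hu', hu1', hu2', hu3'⟩ := key z' h' (by omega)
    obtain rfl := hT.adj_unique_of_dist_eq_add_one hu hu' hu2 hu2'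
    exact ih hu3 hu3' (by omega) hu1

theorem eq_of_adj_of_mem_halfTree (hT : G.IsTree) {a b p q : V} (hab : G.Adj a b)
    (hpq : G.Adj p q) (hp : p ∈ G.halfTree a b) (hq : q ∈ G.halfTree b a) : p = b ∧ q = a := by
  have h1 := hT.dist_eq_dist_add_one_of_adj a hpq
  have h2 := hT.dist_eq_dist_add_one_of_adj b hpq
  rw [mem_halfTree, dist_comm, dist_comm (u := p)] at hp
  rw [mem_halfTree, dist_comm, dist_comm (u := q)] at hq
  have hpb : p = b := by
    by_contra hne
    obtain ⟨u, hu, hud⟩ := hT.connected.exists_adj_dist_eq_add_one (Ne.symm hne)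
    have h3 := hT.dist_eq_dist_add_one_of_adj a hu
    have h4 := hT.dist_eq_dist_add_one_of_adj u hab
    rw [dist_comm (u := u), dist_comm (u := u)] at h4
    obtain rfl := hT.adj_unique_of_dist_eq_add_one hu hpq.symm
      (x := a) (by omega) (by omega)
    omega
  subst hpb
  refine ⟨rfl, ?_⟩
  have : G.dist a p = 1 := dist_eq_one_iff_adj.2 hab
  have h0 : G.dist p p = 0 := dist_self
  have : G.dist a q = 0 := by omega
  exact (hT.connected.dist_eq_zero_iff.1 this).symm

theorem dist_eq_of_mem_halfTree (hT : G.IsTree) {a b x y : V} (hab : G.Adj a b)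
    (hx : x ∈ G.halfTree a b) (hy : y ∈ G.halfTree b a) :
    G.dist x y = G.dist x b + 1 + G.dist a y := by
  induction hk : G.dist x y generalizing y with
  | zero =>
    rw [hT.connected.dist_eq_zero_iff] at hk
    subst hk
    rw [mem_halfTree] at hx hy
    omega
  | succ k ih =>
    have hne : x ≠ y := by rintro rfl; simp at hk
    obtain ⟨u, hu, hud⟩ := hT.connected.exists_adj_dist_eq_add_one hne
    by_cases hub : u ∈ G.halfTree b a
    · have h1 := ih hub (by omega)
      have h2 := hT.dist_eq_dist_add_one_of_adj a hu
      have h3 := hT.connected.dist_triangle (u := x) (v := b) (w := y)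
      rw [mem_halfTree, dist_comm, dist_comm (v := a)] at hy
      omega
    · rw [hT.notMem_halfTree_iff hab.symm] at hub
      obtain ⟨rfl, rfl⟩ := hT.eq_of_adj_of_mem_halfTree hab hu hub hy
      simp
      omega

theorem halfTree_convex (hT : G.IsTree) {a b u v w : V} (hab : G.Adj a b)
    (hu : u ∈ G.halfTree a b) (hv : v ∈ G.halfTree a b)
    (hw : G.dist u w + G.dist w v = G.dist u v) : w ∈ G.halfTree a b := by
  by_contra h
  rw [hT.notMem_halfTree_iff hab] at h
  have h1 := hT.dist_eq_of_mem_halfTree hab hu h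
  have h2 := hT.dist_eq_of_mem_halfTree hab hv h
  have h3 := hT.connected.dist_triangle (u := u) (v := b) (w := v)
  rw [dist_comm (u := v) (v := w)] at h2
  rw [dist_comm (u := b) (v := v)] at h3
  omega

theorem halfTree_subset (hT : G.IsTree) {a b c d : V} (hab : G.Adj a b) (hcd : G.Adj c d)
    (hc : c ∈ G.halfTree a b) (ha : a ∈ G.halfTree d c) :
    G.halfTree c d ⊆ G.halfTree a b := by
  intro x hx
  by_contra h
  rw [hT.notMem_halfTree_iff hab] at h
  have h1 := hT.dist_eq_of_mem_halfTree hab hc h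
  have h2 := hT.dist_eq_of_mem_halfTree hcd hx ha
  rw [mem_halfTree] at hx
  rw [dist_comm (u := c) (v := x)] at h1
  rw [dist_comm (u := x) (v := a)] at h2
  omega

/-- A path without backtracking in a tree is geodesic. -/
theorem dist_eq_of_adj_of_ne (hT : G.IsTree) {r : ℕ → V} (hadj : ∀ n, G.Adj (r n) (r (n + 1)))
    (hne : ∀ n, r (n + 2) ≠ r n) (m n : ℕ) : G.dist (r m) (r (m + n)) = n := by
  induction n using Nat.strong_induction_on with
  | _ n ih =>
    match n with
    | 0 => simp
    | 1 => exact dist_eq_one_iff_adj.2 (hadj m)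
    | k + 2 =>
      have h0 := ih k (by omega)
      have h1 := ih (k + 1) (by omega)
      have h2 := hT.dist_eq_dist_add_one_of_adj (r m) (hadj (m + (k + 1)))
      rcases h2 with h2 | h2
      · exact absurd (hT.adj_unique_of_dist_eq_add_one (hadj (m + (k + 1))).symm
          (hadj (m + k)) h2 (h1.trans (by omega))) (hne (m + k))
      · exact h2.trans (by omega)

end IsTree

end SimpleGraph

section Ray

variable {G : SimpleGraph V}

theorem isGeodRay_of_adj_of_ne (hT : G.IsTree) {r : ℕ → V}
    (hadj : ∀ n, G.Adj (r n) (r (n + 1))) (hne : ∀ n, r (n + 2) ≠ r n) : IsGeodRay G r := by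
  refine ⟨fun i j hij => ?_, hadj⟩
  wlog h : i ≤ j generalizing i j
  · exact (this j i hij.symm (by omega)).symm
  have := hT.dist_eq_of_adj_of_ne hadj hne i (j - i)
  rw [Nat.add_sub_cancel' h, hij, SimpleGraph.dist_self] at this
  omega

theorem isGeodRay_of_dist_eq {r : ℕ → V} {x : V} (hadj : ∀ n, G.Adj (r n) (r (n + 1)))
    (hd : ∀ n, G.dist x (r n) = n) : IsGeodRay G r :=
  ⟨fun i j hij => by rw [← hd i, ← hd j, hij], hadj⟩

namespace IsGeodRay

theorem ne_add_two {r : ℕ → V} (hr : IsGeodRay G r) (n : ℕ) : r (n + 2) ≠ r n :=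
  fun h => by have := hr.1 h; omega

theorem dist_eq (hT : G.IsTree) {r : ℕ → V} (hr : IsGeodRay G r) (m n : ℕ) :
    G.dist (r m) (r (m + n)) = n :=
  hT.dist_eq_of_adj_of_ne hr.2 hr.ne_add_two m n

theorem dist_zero (hT : G.IsTree) {r : ℕ → V} (hr : IsGeodRay G r) (n : ℕ) :
    G.dist (r 0) (r n) = n := by
  simpa using hr.dist_eq hT 0 n

/-- A ray from `x` passing through a descendant of `v` passes through `v`. -/
theorem eq_of_dist_add_dist_eq (hT : G.IsTree) {r : ℕ → V} (hr : IsGeodRay G r) {v : V} {m : ℕ}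
    (h : G.dist (r 0) v + G.dist v (r m) = G.dist (r 0) (r m)) : r (G.dist (r 0) v) = v := by
  have hm := hr.dist_zero hT m
  refine hT.eq_of_dist_add_dist_eq (x := r 0) (y := r m) ?_ h (hr.dist_zero hT _)
  have := hr.dist_eq hT (G.dist (r 0) v) (m - G.dist (r 0) v)
  rw [Nat.add_sub_cancel' (by omega)] at this
  rw [hr.dist_zero hT, this]
  omega

theorem dist_eq_of_ne (hT : G.IsTree) {r s : ℕ → V} (hr : IsGeodRay G r) (hs : IsGeodRay G s)
    {m : ℕ} (h : r m = s m) (hne : r (m + 1) ≠ s (m + 1)) (i j : ℕ) :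
    G.dist (r (m + 1 + i)) (s (m + 1 + j)) = i + j + 2 := by
  have h1 := hr.dist_eq hT m (1 + i)
  have h2 := hr.dist_eq hT (m + 1) i
  have h3 := hs.dist_eq hT m (1 + j)
  have h4 := hs.dist_eq hT (m + 1) j
  rw [← add_assoc] at h1 h3
  have hx : r (m + 1 + i) ∈ G.halfTree (r m) (r (m + 1)) := by
    rw [SimpleGraph.mem_halfTree, SimpleGraph.dist_comm, SimpleGraph.dist_comm (v := r (m + 1))]
    omega
  have hy : s (m + 1 + j) ∈ G.halfTree (r (m + 1)) (r m) := by
    rw [← hT.notMem_halfTree_iff (hr.2 m)]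
    intro hy
    rw [SimpleGraph.mem_halfTree] at hy
    refine hne (hT.adj_unique_of_dist_eq_add_one (hr.2 m).symm (h ▸ (hs.2 m).symm) hy ?_)
    rw [SimpleGraph.dist_comm, SimpleGraph.dist_comm (v := s (m + 1)), h4, h, h3]
    omega
  have h5 := hT.dist_eq_of_mem_halfTree (hr.2 m) hx hy
  rw [SimpleGraph.dist_comm (u := r (m + 1 + i)) (v := r (m + 1)), h2, h, h3] at h5
  omega

/-- In a tree every end is represented by a ray starting at any given vertex. -/
theorem exists_rayEquiv (hT : G.IsTree) {r : ℕ → V} (hr : IsGeodRay G r) (x : V) :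
    ∃ s, IsGeodRay G s ∧ s 0 = x ∧ RayEquiv s r := by
  induction hk : G.dist x (r 0) generalizing r with
  | zero => exact ⟨r, hr, (hT.connected.dist_eq_zero_iff.1 hk).symm, 0, 0, fun _ => rfl⟩
  | succ k ih =>
    have hne : x ≠ r 0 := by rintro h; simp [h] at hk
    obtain ⟨u, hu, hud⟩ := hT.connected.exists_adj_dist_eq_add_one hne
    by_cases h1 : u = r 1
    · obtain ⟨s, hs, hs0, a, b, hab⟩ := ih (r := fun n => r (n + 1))
        ⟨fun i j hij => by simpa using hr.1 hij, fun n => hr.2 (n + 1)⟩ (by simp [← h1]; omega)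
      exact ⟨s, hs, hs0, a, b + 1, fun n => by rw [hab, add_right_comm]⟩
    · obtain ⟨s, hs, hs0, a, b, hab⟩ := ih (r := fun n => Nat.casesOn n u r)
        (isGeodRay_of_adj_of_ne hT (by rintro (_ | n); exacts [hu, hr.2 n])
          (by rintro (_ | n); exacts [Ne.symm h1, hr.ne_add_two n])) (by simp; omega)
      refine ⟨s, hs, hs0, a + 1, b, fun n => ?_⟩
      have := hab (n + 1)
      simp only [← add_assoc] at this
      rw [← this, add_right_comm]

end IsGeodRay

namespace RayEquiv

theorem symm {r s : ℕ → V} (h : RayEquiv r s) : RayEquiv s r := by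
  obtain ⟨a, b, h⟩ := h
  exact ⟨b, a, fun n => (h n).symm⟩

theorem trans {r s t : ℕ → V} (h : RayEquiv r s) (h' : RayEquiv s t) : RayEquiv r t := by
  obtain ⟨a, b, h⟩ := h
  obtain ⟨c, d, h'⟩ := h'
  exact ⟨a + c, d + b, fun n => by rw [add_assoc, h, add_left_comm, h', add_assoc]⟩

end RayEquiv

/-- A tree without branch vertex has at most two ends. -/
theorem rayEquiv_or_rayEquiv_of_not_branch (hT : G.IsTree)
    (hbr : ∀ p x y z, G.Adj p x → G.Adj p y → G.Adj p z → x = y ∨ x = z ∨ y = z)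
    {r s t : ℕ → V} (hr : IsGeodRay G r) (hs : IsGeodRay G s) (ht : IsGeodRay G t)
    (hrs : ¬ RayEquiv r s) : RayEquiv t r ∨ RayEquiv t s := by
  have key : ∀ {f g : ℕ → V}, IsGeodRay G f → IsGeodRay G g → f 0 = g 0 → f 1 = g 1 → f = g := by
    intro f g hf hg h0 h1
    have : ∀ n, f n = g n ∧ f (n + 1) = g (n + 1) := by
      intro n
      induction n with
      | zero => exact ⟨h0, h1⟩
      | succ n ih =>
        refine ⟨ih.2, ?_⟩
        have h2 := hbr (f (n + 1)) (f n) (f (n + 2)) (g (n + 2)) (hf.2 n).symm (hf.2 (n + 1))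
          (ih.2 ▸ hg.2 (n + 1))
        rcases h2 with h2 | h2 | h2
        · exact absurd h2.symm (hf.ne_add_two n)
        · exact absurd (h2.symm.trans ih.1) (hg.ne_add_two n)
        · exact h2
    exact funext fun n => (this n).1
  obtain ⟨r', hr', hr0, hrr⟩ := hr.exists_rayEquiv hT (r 0)
  obtain ⟨s', hs', hs0, hss⟩ := hs.exists_rayEquiv hT (r 0)
  obtain ⟨t', ht', ht0, htt⟩ := ht.exists_rayEquiv hT (r 0)
  rcases hbr (r 0) (t' 1) (r' 1) (s' 1) (ht0 ▸ ht'.2 0) (hr0 ▸ hr'.2 0) (hs0 ▸ hs'.2 0) with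
    h | h | h
  · obtain rfl := key ht' hr' (by rw [ht0, hr0]) h
    exact Or.inl (htt.symm.trans hrr)
  · obtain rfl := key ht' hs' (by rw [ht0, hs0]) h
    exact Or.inr (htt.symm.trans hss)
  · obtain rfl := key hr' hs' (by rw [hr0, hs0]) h
    exact absurd (hrr.symm.trans hss) hrs

end Ray

section Action

variable {G : SimpleGraph V} {Γ : Type*} [Group Γ] [MulAction Γ V]

theorem dist_smul_smul_of_adj (hAdj : ∀ (γ : Γ) (u v : V), G.Adj u v → G.Adj (γ • u) (γ • v))
    (hG : G.Connected) (γ : Γ) (u v : V) : G.dist (γ • u) (γ • v) = G.dist u v := by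
  have key : ∀ (γ : Γ) (u v : V), G.dist (γ • u) (γ • v) ≤ G.dist u v := by
    intro γ u v
    obtain ⟨p, hp⟩ := hG.exists_walk_length_eq_dist u v
    let f : G →g G := ⟨(γ • ·), fun h => hAdj γ _ _ h⟩
    rw [← hp, ← p.length_map f]
    exact SimpleGraph.dist_le (p.map f)
  refine le_antisymm (key γ u v) ?_
  simpa using key γ⁻¹ (γ • u) (γ • v)

theorem IsGeodRay.smul (hAdj : ∀ (γ : Γ) (u v : V), G.Adj u v → G.Adj (γ • u) (γ • v))
    {r : ℕ → V} (hr : IsGeodRay G r) (γ : Γ) : IsGeodRay G (fun n => γ • r n) :=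
  ⟨fun _ _ h => hr.1 (MulAction.injective γ h), fun n => hAdj γ _ _ (hr.2 n)⟩

theorem RayEquiv.of_smul {r s : ℕ → V} {γ : Γ}
    (h : RayEquiv (fun n => γ • r n) (fun n => γ • s n)) : RayEquiv r s := by
  obtain ⟨a, b, h⟩ := h
  exact ⟨a, b, fun n => MulAction.injective γ (h n)⟩

/-- For a minimal action on a tree, every orbit meets every half-tree. -/
theorem exists_smul_mem_halfTree (hT : G.IsTree)
    (hdist : ∀ (γ : Γ) (u v : V), G.dist (γ • u) (γ • v) = G.dist u v)
    (hmin : ¬ ∃ S : Set V, S.Nonempty ∧ S ≠ Set.univ ∧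
      (∀ γ : Γ, ∀ v ∈ S, γ • v ∈ S) ∧
      (∀ u ∈ S, ∀ v ∈ S, ∀ w : V,
        G.dist u w + G.dist w v = G.dist u v → w ∈ S))
    {a b : V} (hab : G.Adj a b) (q : V) : ∃ γ : Γ, γ • q ∈ G.halfTree a b := by
  by_contra! h
  refine hmin ⟨{x | ∀ γ : Γ, γ • x ∈ G.halfTree b a}, ⟨q, fun γ => ?_⟩, fun hS => ?_,
    fun γ v hv δ => ?_, fun u hu v hv w hw γ => ?_⟩
  · exact (hT.notMem_halfTree_iff hab).1 (h γ)
  · have hb : b ∈ {x | ∀ γ : Γ, γ • x ∈ G.halfTree b a} := hS ▸ Set.mem_univ b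
    have := hb 1
    rw [one_smul] at this
    exact SimpleGraph.left_notMem_halfTree this
  · rw [← mul_smul]
    exact hv _
  · exact hT.halfTree_convex hab.symm (hu γ) (hv γ) (by rw [hdist, hdist, hdist, hw])

/-- If every orbit meets every half-tree and some vertex is not a leaf, there are no leaves. -/
theorem exists_adj_ne (hT : G.IsTree)
    (hAdj : ∀ (γ : Γ) (u v : V), G.Adj u v → G.Adj (γ • u) (γ • v))
    (horb : ∀ a b q, G.Adj a b → ∃ γ : Γ, γ • q ∈ G.halfTree a b)
    {q y z : V} (hy : G.Adj q y) (hz : G.Adj q z) (hyz : y ≠ z) {u v : V} (huv : G.Adj u v) :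
    ∃ v', G.Adj v v' ∧ v' ≠ u := by
  obtain ⟨γ, hγ⟩ := horb u v q huv
  by_cases h : γ • q = v
  · by_cases h1 : γ • y = u
    · exact ⟨γ • z, h ▸ hAdj γ _ _ hz, fun h2 => hyz (MulAction.injective γ (h1.trans h2.symm))⟩
    · exact ⟨γ • y, h ▸ hAdj γ _ _ hy, h1⟩
  · obtain ⟨v', hv', hd⟩ := hT.connected.exists_adj_dist_eq_add_one h
    refine ⟨v', hv'.symm, ?_⟩
    rintro rfl
    rw [SimpleGraph.mem_halfTree] at hγ
    omega

/-- If every orbit meets every half-tree and there is a branch vertex, then, relative to any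
root, every half-tree contains a vertex with two children. -/
theorem exists_two_children (hT : G.IsTree)
    (hAdj : ∀ (γ : Γ) (u v : V), G.Adj u v → G.Adj (γ • u) (γ • v))
    (horb : ∀ a b q, G.Adj a b → ∃ γ : Γ, γ • q ∈ G.halfTree a b)
    {q x y z : V} (hx : G.Adj q x) (hy : G.Adj q y) (hz : G.Adj q z)
    (hxy : x ≠ y) (hxz : x ≠ z) (hyz : y ≠ z) (o : V) {a b : V} (hab : G.Adj a b) :
    ∃ p ∈ G.halfTree a b, ∃ c c', c ≠ c' ∧ G.Adj p c ∧ G.Adj p c' ∧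
      G.dist o c = G.dist o p + 1 ∧ G.dist o c' = G.dist o p + 1 := by
  obtain ⟨γ, hγ⟩ := horb a b q hab
  have hadj : ∀ {w : V}, G.Adj q w → G.Adj (γ • q) (γ • w) := fun h => hAdj γ _ _ h
  have hinj : ∀ {w w' : V}, w ≠ w' → γ • w ≠ γ • w' :=
    fun h h' => h (MulAction.injective γ h')
  have hparent : ∀ {w w' : V}, G.Adj q w → G.Adj q w' → w ≠ w' →
      G.dist o (γ • q) = G.dist o (γ • w) + 1 → G.dist o (γ • w') = G.dist o (γ • q) + 1 :=
    fun hw hw' hne hd => (hT.dist_eq_dist_add_one_of_adj o (hadj hw')).resolve_left fun hd' =>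
      hinj hne (hT.adj_unique_of_dist_eq_add_one (hadj hw).symm (hadj hw').symm hd hd')
  refine ⟨γ • q, hγ, ?_⟩
  rcases hT.dist_eq_dist_add_one_of_adj o (hadj hx) with h | h
  · exact ⟨_, _, hinj hyz, hadj hy, hadj hz, hparent hx hy hxy h, hparent hx hz hxz h⟩
  rcases hT.dist_eq_dist_add_one_of_adj o (hadj hy) with h' | h'
  · exact ⟨_, _, hinj hxz, hadj hx, hadj hz, h, hparent hy hz hyz h'⟩
  · exact ⟨_, _, hinj hxy, hadj hx, hadj hy, h, h'⟩

/-- If every orbit meets every half-tree and there are no leaves, then every half-tree is mapped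
strictly inside itself by some element of the group. -/
theorem exists_smul_halfTree_ssubset (hT : G.IsTree)
    (hAdj : ∀ (γ : Γ) (u v : V), G.Adj u v → G.Adj (γ • u) (γ • v))
    (horb : ∀ a b q, G.Adj a b → ∃ γ : Γ, γ • q ∈ G.halfTree a b)
    (hleaf : ∀ u v, G.Adj u v → ∃ v', G.Adj v v' ∧ v' ≠ u) {a b : V} (hab : G.Adj a b) :
    ∃ h : Γ, h • a ∈ G.halfTree a b ∧ a ∈ G.halfTree (h • b) (h • a) := by
  have hdist := dist_smul_smul_of_adj hAdj hT.connected
  have hmove : ∀ {a b : V}, G.Adj a b → ∃ g : Γ, g • a ∈ G.halfTree a b ∧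
      g • b ∈ G.halfTree a b := by
    intro a b hab
    obtain ⟨c, hbc, hca⟩ := hleaf a b hab
    obtain ⟨g, hg⟩ := horb b c a hbc
    have hsub : g • a ∈ G.halfTree a b := by
      refine hT.halfTree_subset hab hbc hab.right_mem_halfTree ?_ hg
      rw [← hT.notMem_halfTree_iff hbc, SimpleGraph.mem_halfTree]
      intro h
      have h1 : G.dist a b = 1 := SimpleGraph.dist_eq_one_iff_adj.2 hab
      exact hca (hT.connected.dist_eq_zero_iff.1 (by omega : G.dist a c = 0)).symm
    refine ⟨g, hsub, ?_⟩
    by_contra hb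
    rw [hT.notMem_halfTree_iff hab] at hb
    rw [(hT.eq_of_adj_of_mem_halfTree hab (hAdj g _ _ hab) hsub hb).1] at hg
    exact SimpleGraph.left_notMem_halfTree hg
  obtain ⟨g, hga, hgb⟩ := hmove hab
  obtain ⟨k, hkb, hka⟩ := hmove hab.symm
  have hgab := hAdj g _ _ hab
  have hkab := hAdj k _ _ hab
  have hinv : ∀ (γ : Γ) (u v : V), G.dist (γ⁻¹ • u) v = G.dist u (γ • v) := by
    intro γ u v
    rw [← hdist γ, smul_inv_smul]
  by_cases h1 : a ∈ G.halfTree (g • b) (g • a)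
  · exact ⟨g, hga, h1⟩
  rw [hT.notMem_halfTree_iff hgab.symm] at h1
  by_cases h2 : b ∈ G.halfTree (k • a) (k • b)
  · refine ⟨k⁻¹, ?_, ?_⟩
    · rw [SimpleGraph.mem_halfTree] at hka hkb h2 ⊢
      rw [hinv, hinv, SimpleGraph.dist_comm, SimpleGraph.dist_comm (u := a)]
      rw [SimpleGraph.dist_comm, SimpleGraph.dist_comm (u := b)] at h2
      omega
    · rw [SimpleGraph.mem_halfTree, SimpleGraph.dist_comm, hinv, SimpleGraph.dist_comm (u := a),
        hinv, SimpleGraph.dist_comm, SimpleGraph.dist_comm (u := a)]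
      exact hka
  · rw [hT.notMem_halfTree_iff hkab] at h2
    refine ⟨g * k, ?_, ?_⟩
    · rw [mul_smul]
      refine hT.halfTree_subset hab hgab.symm hgb h1 ?_
      simpa only [SimpleGraph.mem_halfTree, hdist] using hka
    · have h3 : g⁻¹ • a ∈ G.halfTree (k • b) (k • a) := by
        rw [← hT.notMem_halfTree_iff hkab]
        intro h3
        have h4 := hT.halfTree_subset hab.symm hkab hka h2 h3
        simp only [SimpleGraph.mem_halfTree, hinv] at h1 h4
        omega
      simpa only [SimpleGraph.mem_halfTree, hinv, mul_smul] using h3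

/-- If an element of the group maps a half-tree strictly inside itself, then only the identity
fixes that half-tree pointwise. -/
theorem eq_one_of_fixes_halfTree (hT : G.IsTree)
    (hAdj : ∀ (γ : Γ) (u v : V), G.Adj u v → G.Adj (γ • u) (γ • v))
    (hfaith : ∀ γ : Γ, (∀ v : V, γ • v = v) → γ = 1)
    (hdisc : ∀ v : V, Finite (MulAction.stabilizer Γ v))
    {a b : V} (hab : G.Adj a b) {h : Γ} (ha : h • a ∈ G.halfTree a b)
    (ha' : a ∈ G.halfTree (h • b) (h • a)) {α : Γ} (hα : ∀ v ∈ G.halfTree a b, α • v = v) :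
    α = 1 := by
  have hdist := dist_smul_smul_of_adj hAdj hT.connected
  have hhab := hAdj h _ _ hab
  have hsmul : ∀ v ∈ G.halfTree a b, h • v ∈ G.halfTree a b := by
    intro v hv
    refine hT.halfTree_subset hab hhab ha ha' ?_
    simpa only [SimpleGraph.mem_halfTree, hdist] using hv
  have habsorb : ∀ v : V, ∃ n : ℕ, h ^ n • v ∈ G.halfTree a b := by
    intro v
    induction hk : G.dist v a using Nat.strong_induction_on generalizing v with
    | _ k ih =>
      by_cases hv : h • v ∈ G.halfTree a b
      · exact ⟨1, by simpa using hv⟩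
      · have h1 := hT.dist_eq_of_mem_halfTree hab ha ((hT.notMem_halfTree_iff hab).1 hv)
        rw [SimpleGraph.dist_comm, hdist, SimpleGraph.dist_comm (v := h • v)] at h1
        obtain ⟨n, hn⟩ := ih (G.dist (h • v) a) (by omega) (h • v) rfl
        exact ⟨n + 1, by rwa [pow_succ, mul_smul]⟩
  have hpow : ∀ (n : ℕ), ∀ v ∈ G.halfTree a b, h ^ n • v ∈ G.halfTree a b := by
    intro n
    induction n with
    | zero => simp
    | succ n ih => exact fun v hv => by rw [pow_succ, mul_smul]; exact ih _ (hsmul v hv)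
  have hmem : ∀ n : ℕ, (h ^ n)⁻¹ * α * h ^ n ∈ MulAction.stabilizer Γ b := by
    intro n
    rw [MulAction.mem_stabilizer_iff, mul_smul, mul_smul,
      hα _ (hpow n b hab.right_mem_halfTree), inv_smul_smul]
  have := hdisc b
  obtain ⟨m, n, hmn, heq⟩ := Finite.exists_ne_map_eq_of_infinite
    (fun n : ℕ => (⟨_, hmem n⟩ : MulAction.stabilizer Γ b))
  wlog hlt : m < n generalizing m n
  · exact this n m hmn.symm heq.symm (by omega)
  replace heq : (h ^ m)⁻¹ * α * h ^ m = (h ^ n)⁻¹ * α * h ^ n := congrArg Subtype.val heq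
  obtain ⟨d, rfl⟩ := Nat.exists_eq_add_of_lt hlt
  have hcomm : Commute α (h ^ (d + 1)) := by
    rw [add_assoc, add_comm m, pow_add, mul_inv_rev] at heq
    simp only [mul_assoc, mul_right_inj] at heq
    simp only [← mul_assoc, mul_left_inj] at heq
    rw [mul_assoc, eq_inv_mul_iff_mul_eq] at heq
    exact heq.symm
  refine hfaith α fun v => ?_
  obtain ⟨N, hN⟩ := habsorb v
  have hN' : (h ^ (d + 1)) ^ N • v ∈ G.halfTree a b := by
    rw [← pow_mul, add_mul, one_mul, pow_add, mul_smul]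
    exact hpow _ _ hN
  have := hα _ hN'
  rw [← mul_smul, (hcomm.pow_right N).eq, mul_smul] at this
  exact MulAction.injective _ this

end Action

section Ends

variable {G : SimpleGraph V}

namespace SimpleGraph

theorem IsTree.dist_add_dist_eq_of_mem_halfTree (hT : G.IsTree) {o a b v : V} (hab : G.Adj a b)
    (hd : G.dist o b = G.dist o a + 1) (hv : v ∈ G.halfTree a b) :
    G.dist o b + G.dist b v = G.dist o v := by
  have := hT.dist_eq_of_mem_halfTree hab hv hd
  rw [dist_comm, dist_comm (u := v), dist_comm (u := a)] at this
  omega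

theorem Connected.dist_add_dist_eq_trans (hG : G.Connected) {o u v x : V}
    (huv : G.dist o u + G.dist u v = G.dist o v) (hvx : G.dist o v + G.dist v x = G.dist o x) :
    G.dist o u + G.dist u x = G.dist o x := by
  have h1 := hG.dist_triangle (u := u) (v := v) (w := x)
  have h2 := hG.dist_triangle (u := o) (v := u) (w := x)
  omega

end SimpleGraph

/-- A path moving away from `o` extends backwards to a geodesic ray from `o`. -/
theorem exists_isGeodRay_extending (hT : G.IsTree) {o : V} {k : ℕ} {t : ℕ → V}
    (hadj : ∀ n, G.Adj (t n) (t (n + 1))) (hd : ∀ n, G.dist o (t n) = k + n) :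
    ∃ r, IsGeodRay G r ∧ r 0 = o ∧ ∀ n, r (k + n) = t n := by
  induction k generalizing t with
  | zero =>
    refine ⟨t, isGeodRay_of_dist_eq hadj (x := o) (by simpa using hd), ?_, by simp⟩
    exact (hT.connected.dist_eq_zero_iff.1 (by simpa using hd 0)).symm
  | succ k ih =>
    have h0 : G.dist o (t 0) = k + 1 := hd 0
    have hne : o ≠ t 0 := by rintro h; simp [← h] at h0
    obtain ⟨u, hu, hud⟩ := hT.connected.exists_adj_dist_eq_add_one hne
    obtain ⟨r, hr, hr0, hrt⟩ := ih (t := fun n => Nat.casesOn n u t)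
      (by rintro (_ | n); exacts [hu, hadj n])
      (by
        rintro (_ | n)
        · show G.dist o u = _
          omega
        · show G.dist o (t n) = _
          rw [hd]
          omega)
    exact ⟨r, hr, hr0, fun n => by rw [add_right_comm]; exact hrt (n + 1)⟩

/-- In a tree without leaves, every vertex lies on a ray from `o`. -/
theorem exists_isGeodRay_through (hT : G.IsTree)
    (hleaf : ∀ u v, G.Adj u v → ∃ v', G.Adj v v' ∧ v' ≠ u) {o v : V} (hov : o ≠ v) :
    ∃ r, IsGeodRay G r ∧ r 0 = o ∧ r (G.dist o v) = v := by
  have hchild : ∀ v, ∃ c, o ≠ v → G.Adj v c ∧ G.dist o c = G.dist o v + 1 := by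
    intro v
    by_cases hv : o = v
    · exact ⟨v, fun h => absurd hv h⟩
    obtain ⟨u, hu, hud⟩ := hT.connected.exists_adj_dist_eq_add_one hv
    obtain ⟨c, hc, hcu⟩ := hleaf u v hu
    refine ⟨c, fun _ => ⟨hc, (hT.dist_eq_dist_add_one_of_adj o hc).resolve_left fun h => ?_⟩⟩
    exact hcu (hT.adj_unique_of_dist_eq_add_one hc.symm hu h hud)
  choose c hc using hchild
  have hd : ∀ n, G.dist o (c^[n] v) = G.dist o v + n ∧ o ≠ c^[n] v := by
    intro n
    induction n with
    | zero => exact ⟨rfl, hov⟩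
    | succ n ih =>
      rw [Function.iterate_succ_apply']
      have := (hc _ ih.2).2
      refine ⟨by omega, fun h => ?_⟩
      rw [← h, SimpleGraph.dist_self] at this
      omega
  obtain ⟨r, hr, hr0, hrt⟩ := exists_isGeodRay_extending hT (t := fun n => c^[n] v)
    (fun n => by rw [Function.iterate_succ_apply']; exact (hc _ (hd n).2).1) fun n => (hd n).1
  exact ⟨r, hr, hr0, hrt 0⟩

section Action

variable {Γ : Type*} [Group Γ] [MulAction Γ V]

/-- An infinite tree with an action fixing no end and no pair of ends has a branch vertex. -/
theorem exists_branch (hT : G.IsTree)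
    (hAdj : ∀ (γ : Γ) (u v : V), G.Adj u v → G.Adj (γ • u) (γ • v))
    (hne3 : ¬ ∃ r : ℕ → V, IsGeodRay G r ∧
      ∀ γ : Γ, RayEquiv (fun n => γ • r n) r)
    (hne4 : ¬ ∃ r s : ℕ → V, IsGeodRay G r ∧ IsGeodRay G s ∧ ¬ RayEquiv r s ∧
      ∀ γ : Γ, (RayEquiv (fun n => γ • r n) r ∧ RayEquiv (fun n => γ • s n) s) ∨
        (RayEquiv (fun n => γ • r n) s ∧ RayEquiv (fun n => γ • s n) r))
    {r : ℕ → V} (hr : IsGeodRay G r) :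
    ∃ p x y z, G.Adj p x ∧ G.Adj p y ∧ G.Adj p z ∧ x ≠ y ∧ x ≠ z ∧ y ≠ z := by
  by_contra! hbr
  replace hbr : ∀ p x y z, G.Adj p x → G.Adj p y → G.Adj p z → x = y ∨ x = z ∨ y = z := by
    intro p x y z hx hy hz
    by_contra! h
    exact h.2.2 (hbr p x y z hx hy hz h.1 h.2.1)
  obtain ⟨γ₀, hγ₀⟩ : ∃ γ : Γ, ¬ RayEquiv (fun n => γ • r n) r := by
    by_contra! h
    exact hne3 ⟨r, hr, h⟩
  have hs := hr.smul hAdj γ₀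
  set s := fun n => γ₀ • r n
  have hrs : ¬ RayEquiv r s := fun h => hγ₀ h.symm
  refine hne4 ⟨r, s, hr, hs, hrs, fun γ => ?_⟩
  have h1 := rayEquiv_or_rayEquiv_of_not_branch hT hbr hr hs (hr.smul hAdj γ) hrs
  have h2 := rayEquiv_or_rayEquiv_of_not_branch hT hbr hr hs (hs.smul hAdj γ) hrs
  rcases h1 with h1 | h1 <;> rcases h2 with h2 | h2
  · exact absurd (h1.trans h2.symm).of_smul hrs
  · exact Or.inl ⟨h1, h2⟩
  · exact Or.inr ⟨h1, h2⟩
  · exact absurd (h1.trans h2.symm).of_smul hrs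

/-- The signed translation amounts of an isometry along two diverging rays whose ends it fixes
add up to zero. -/
theorem add_eq_add_of_smul_eq (hT : G.IsTree) {α : Γ}
    (hdist : ∀ u v : V, G.dist (α • u) (α • v) = G.dist u v)
    {r s : ℕ → V} (hr : IsGeodRay G r) (hs : IsGeodRay G s) {m : ℕ} (h : r m = s m)
    (hne : r (m + 1) ≠ s (m + 1)) {a b c d : ℕ} (hrα : ∀ n, α • r (a + n) = r (b + n))
    (hsα : ∀ n, α • s (c + n) = s (d + n)) : a + c = b + d := by
  have h1 := hr.dist_eq_of_ne hT hs h hne a c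
  have h2 := hr.dist_eq_of_ne hT hs h hne b d
  rw [← hdist, add_comm (m + 1), add_comm (m + 1), hrα, hsα, add_comm b, add_comm d, h2] at h1
  omega

/-- An isometry fixing two diverging rays far out fixes them after their divergence. -/
theorem smul_eq_of_smul_eq (hT : G.IsTree) {α : Γ}
    (hdist : ∀ u v : V, G.dist (α • u) (α • v) = G.dist u v)
    {r s : ℕ → V} (hr : IsGeodRay G r) (hs : IsGeodRay G s) {m : ℕ} (h : r m = s m)
    (hne : r (m + 1) ≠ s (m + 1)) {a c : ℕ} (hrα : ∀ n, α • r (a + n) = r (a + n))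
    (hsα : ∀ n, α • s (c + n) = s (c + n)) (i : ℕ) : α • r (m + 1 + i) = r (m + 1 + i) := by
  have hx : α • r (m + 1 + (i + a)) = r (m + 1 + (i + a)) := by
    rw [← add_assoc, add_comm _ a, hrα]
  have hy : α • s (m + 1 + c) = s (m + 1 + c) := by
    rw [add_comm _ c, hsα]
  have h1 := hr.dist_eq_of_ne hT hs h hne (i + a) c
  have h2 := hr.dist_eq_of_ne hT hs h hne i c
  have h3 := hr.dist_eq hT (m + 1 + i) a
  rw [SimpleGraph.dist_comm, add_assoc] at h3
  have hxz := hdist (r (m + 1 + (i + a))) (r (m + 1 + i))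
  have hzy := hdist (r (m + 1 + i)) (s (m + 1 + c))
  rw [hx] at hxz
  rw [hy] at hzy
  exact hT.eq_of_dist_add_dist_eq (x := r (m + 1 + (i + a))) (y := s (m + 1 + c))
    (by omega) (by omega) (by omega)

/-- If every half-tree contains a vertex with two children relative to the root `o`, an isometry
fixing all ends of a half-tree fixes some smaller half-tree pointwise. -/
theorem exists_halfTree_fixed (hT : G.IsTree) {α : Γ}
    (hdist : ∀ u v : V, G.dist (α • u) (α • v) = G.dist u v)
    (hleaf : ∀ u v, G.Adj u v → ∃ v', G.Adj v v' ∧ v' ≠ u) {o : V}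
    (hchild : ∀ a b, G.Adj a b → ∃ p ∈ G.halfTree a b, ∃ c c', c ≠ c' ∧ G.Adj p c ∧
      G.Adj p c' ∧ G.dist o c = G.dist o p + 1 ∧ G.dist o c' = G.dist o p + 1)
    {u w : V} (huw : G.Adj u w) (hd : G.dist o w = G.dist o u + 1)
    (hfix : ∀ r : ℕ → V, IsGeodRay G r → r 0 = o → (∃ n, r n = w) →
      RayEquiv (fun n => α • r n) r) :
    ∃ a b, G.Adj a b ∧ ∀ v ∈ G.halfTree a b, α • v = v := by
  obtain ⟨p, hp, c, c', hcc, hpc, hpc', hc, hc'⟩ := hchild u w huw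
  obtain ⟨q, hq, b, b', hbb, hqb, hqb', hb, hb'⟩ := hchild p c hpc
  have hray : ∀ v, G.dist o w + G.dist w v = G.dist o v → ∃ f, IsGeodRay G f ∧
      (∀ y, G.dist o y + G.dist y v = G.dist o v → f (G.dist o y) = y) ∧
      ∃ i j : ℕ, ∀ n, α • f (i + n) = f (j + n) := by
    intro v hv
    have hov : o ≠ v := by
      rintro rfl
      simp only [SimpleGraph.dist_self] at hv
      omega
    obtain ⟨f, hf, rfl, hfv⟩ := exists_isGeodRay_through hT hleaf hov
    have hthrough : ∀ y, G.dist (f 0) y + G.dist y v = G.dist (f 0) v →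
        f (G.dist (f 0) y) = y := fun y hy =>
      hf.eq_of_dist_add_dist_eq hT (m := G.dist (f 0) v) (by rw [hfv]; exact hy)
    exact ⟨f, hf, hthrough, hfix f hf rfl ⟨_, hthrough w hv⟩⟩
  have hstep : ∀ {x y : V}, G.Adj x y → G.dist o y = G.dist o x + 1 →
      G.dist o x + G.dist x y = G.dist o y := fun hxy h => by
    rw [SimpleGraph.dist_eq_one_iff_adj.2 hxy, h]
  have htrans := @SimpleGraph.Connected.dist_add_dist_eq_trans _ _ hT.connected o
  have hwp := hT.dist_add_dist_eq_of_mem_halfTree huw hd hp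
  have hcq := hT.dist_add_dist_eq_of_mem_halfTree hpc hc hq
  have hpq := htrans (hstep hpc hc) hcq
  obtain ⟨s, hs, hst, i, i', hsα⟩ := hray b' (htrans (htrans hwp hpq) (hstep hqb' hb'))
  obtain ⟨t, ht, htt, j, j', htα⟩ := hray c' (htrans hwp (hstep hpc' hc'))
  have hsq := hst q (hstep hqb' hb')
  have hsb := hst b' (by simp)
  have hsp := hst p (htrans hpq (hstep hqb' hb'))
  have hsc := hst c (htrans hcq (hstep hqb' hb'))
  have htp := htt p (hstep hpc' hc')
  have htc := htt c' (by simp)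
  rw [hb'] at hsb
  rw [hc] at hsc
  rw [hc'] at htc
  refine ⟨q, b, hqb, fun v hv => ?_⟩
  have hbv := hT.dist_add_dist_eq_of_mem_halfTree hqb hb hv
  have hqv := htrans (hstep hqb hb) hbv
  obtain ⟨f, hf, hft, k, k', hfα⟩ := hray v (htrans (htrans hwp hpq) hqv)
  have hfq := hft q hqv
  have hfb := hft b hbv
  have hfp := hft p (htrans hpq hqv)
  have hfc := hft c (htrans hcq hqv)
  have hfv := hft v (by simp)
  rw [hb] at hfb
  rw [hc] at hfc
  have hfs := add_eq_add_of_smul_eq hT hdist hf hs (hfq.trans hsq.symm)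
    (by rwa [hfb, hsb]) hfα hsα
  have hft' := add_eq_add_of_smul_eq hT hdist hf ht (hfp.trans htp.symm)
    (by rwa [hfc, htc]) hfα htα
  have hst' := add_eq_add_of_smul_eq hT hdist hs ht (hsp.trans htp.symm)
    (by rwa [hsc, htc]) hsα htα
  obtain rfl : k = k' := by omega
  obtain rfl : i = i' := by omega
  have := smul_eq_of_smul_eq hT hdist hf hs (hfq.trans hsq.symm) (by rwa [hfb, hsb]) hfα hsα
    (G.dist o v - (G.dist o q + 1))
  rwa [Nat.add_sub_cancel' (by omega), hfv] at this

end Action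

end Ends

/-- Let `Γ` be a discrete non-elementary group of automorphisms of a locally
finite tree `T` with no proper nonempty invariant subtree (minimality).  If
`α ∈ Γ` fixes pointwise a nonempty open subset of the boundary `∂T` — encoded
here as the (nonempty) shadow of a vertex `w ≠ x₀`, a basic open set: `α`
fixes the end of every geodesic ray from `x₀` through `w` — then `α` is the
identity. -/
theorem stmt_8 (G : SimpleGraph V) (hT : G.IsTree) [G.LocallyFinite]
    (Γ : Type*) [Group Γ] [MulAction Γ V]
    (hAdj : ∀ (γ : Γ) (u v : V), G.Adj u v → G.Adj (γ • u) (γ • v))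
    (hfaith : ∀ γ : Γ, (∀ v : V, γ • v = v) → γ = 1)
    (hdisc : ∀ v : V, Finite (MulAction.stabilizer Γ v))
    -- Γ is non-elementary: it preserves no point nor pair of points of T ∪ ∂T
    (hne1 : ¬ ∃ v : V, ∀ γ : Γ, γ • v = v)
    (hne2 : ¬ ∃ u v : V, ∀ γ : Γ, ({γ • u, γ • v} : Set V) = {u, v})
    (hne3 : ¬ ∃ r : ℕ → V, IsGeodRay G r ∧
      ∀ γ : Γ, RayEquiv (fun n => γ • r n) r)
    (hne4 : ¬ ∃ r s : ℕ → V, IsGeodRay G r ∧ IsGeodRay G s ∧ ¬ RayEquiv r s ∧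
      ∀ γ : Γ, (RayEquiv (fun n => γ • r n) r ∧ RayEquiv (fun n => γ • s n) s) ∨
        (RayEquiv (fun n => γ • r n) s ∧ RayEquiv (fun n => γ • s n) r))
    -- minimality: no proper nonempty invariant subtree
    (hmin : ¬ ∃ S : Set V, S.Nonempty ∧ S ≠ Set.univ ∧
      (∀ γ : Γ, ∀ v ∈ S, γ • v ∈ S) ∧
      (∀ u ∈ S, ∀ v ∈ S, ∀ w : V,
        G.dist u w + G.dist w v = G.dist u v → w ∈ S))
    (α : Γ) (x₀ w : V) (hw : w ≠ x₀)
    (hwray : ∃ r : ℕ → V, IsGeodRay G r ∧ r 0 = x₀ ∧ ∃ n, r n = w)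
    (hfixU : ∀ r : ℕ → V, IsGeodRay G r → r 0 = x₀ → (∃ n, r n = w) →
      RayEquiv (fun n => α • r n) r) :
    α = 1 := by
  have hdist := dist_smul_smul_of_adj hAdj hT.connected
  obtain ⟨r, hr, rfl, n, rfl⟩ := hwray
  obtain ⟨m, rfl⟩ := Nat.exists_eq_succ_of_ne_zero (by rintro rfl; exact hw rfl : n ≠ 0)
  have horb : ∀ a b q, G.Adj a b → ∃ γ : Γ, γ • q ∈ G.halfTree a b :=
    fun a b q hab => exists_smul_mem_halfTree hT hdist hmin hab q
  have hleaf : ∀ u v, G.Adj u v → ∃ v', G.Adj v v' ∧ v' ≠ u := fun u v huv =>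
    exists_adj_ne hT hAdj horb (hr.2 0).symm (hr.2 1) (hr.ne_add_two 0).symm huv
  obtain ⟨p, x, y, z, hx, hy, hz, hxy, hxz, hyz⟩ := exists_branch hT hAdj hne3 hne4 hr
  obtain ⟨a, b, hab, hfix⟩ := exists_halfTree_fixed hT (hdist α) hleaf
    (fun a b hab => exists_two_children hT hAdj horb hx hy hz hxy hxz hyz (r 0) hab)
    (hr.2 m) (by rw [hr.dist_zero hT, hr.dist_zero hT]) hfixU
  obtain ⟨h, ha, ha'⟩ := exists_smul_halfTree_ssubset hT hAdj horb hleaf hab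
  exact eq_one_of_fixes_halfTree hT hAdj hfaith hdisc hab ha ha' hfix
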